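/- For every n ≥ 1, let μ_k = (1/b_n)·Σ_{V(T)=n} (J(T) − (n−1)/2)^k ∈ ℚ be the k-th central moment of the number-of-jumps statistic over the uniform distribution on full binary trees with n internal vertices. Then μ_8·(8n⁹ − 60n⁸ + 118n⁷ + 75n⁶ − 402n⁵ + 135n⁴ + 418n³ − 255n² − 142n + 105) = μ_2⁴·(840n⁹ − 7980n⁸ + 27006n⁷ − 38933n⁶ + 23070n⁵ − 6937n⁴ + 3178n³ − 1167n² − 142n + 105); equivalently, whenever μ_2 ≠ 0, the scaled eighth central moment μ_8/μ_2⁴ equals the corresponding rational function of n. -/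

import Mathlib

inductive BTree : Type
  | leaf : BTree
  | node : BTree → BTree → BTree

namespace BTree

/-- number of internal vertices -/
def V : BTree → ℕ
  | leaf => 0
  | node l r => V l + V r + 1

/-- depth of the rightmost leaf -/
def D : BTree → ℕ
  | leaf => 0
  | node _ r => 1 + D r

/-- number of jumps -/
def J : BTree → ℕ
  | leaf => 0
  | node leaf r => J r
  | node (node l₁ r₁) r => J (node l₁ r₁) + J r + 1

/-- sum of jump distances -/
def JD : BTree → ℕ
  | leaf => 0
  | node l r => JD l + JD r + D l

end BTree

namespace BTree

open Finset

theorem finite_V (n : ℕ) : {T : BTree | T.V = n}.Finite := by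
  induction n using Nat.strong_induction_on with
  | _ n ih =>
    have h : {T : BTree | T.V = n} ⊆ {leaf} ∪ ⋃ i ∈ Set.Iio n, ⋃ j ∈ Set.Iio n,
        Set.image2 node {T : BTree | T.V = i} {T : BTree | T.V = j} := by
      intro T hT
      cases T with
      | leaf => simp
      | node l r =>
        simp only [Set.mem_setOf_eq, V] at hT
        right
        simp only [Set.mem_iUnion, Set.mem_Iio]
        exact ⟨l.V, by omega, r.V, by omega, l, rfl, r, rfl, rfl⟩
    refine Set.Finite.subset ?_ h
    refine (Set.finite_singleton _).union ?_
    refine Set.Finite.biUnion (Set.finite_Iio n) fun i hi => ?_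
    refine Set.Finite.biUnion (Set.finite_Iio n) fun j hj => ?_
    exact Set.Finite.image2 _ (ih i hi) (ih j hj)

/-- the finset of trees with n internal vertices -/
noncomputable def ts (n : ℕ) : Finset BTree := (finite_V n).toFinset

theorem mem_ts {n : ℕ} {T : BTree} : T ∈ ts n ↔ T.V = n := by simp [ts]

theorem sum_ts_succ {M : Type*} [AddCommMonoid M] (f : BTree → M) (n : ℕ) :
    ∑ T ∈ ts (n + 1), f T =
      ∑ p ∈ antidiagonal n, ∑ l ∈ ts p.1, ∑ r ∈ ts p.2, f (node l r) := by
  simp_rw [← Finset.sum_product']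
  rw [Finset.sum_sigma']
  symm
  refine Finset.sum_bij (fun a _ => node a.2.1 a.2.2) ?_ ?_ ?_ ?_
  · rintro ⟨⟨i, j⟩, l, r⟩ h
    simp only [mem_sigma, HasAntidiagonal.mem_antidiagonal, mem_product, mem_ts] at h
    simp only [mem_ts, V]
    omega
  · rintro ⟨⟨i, j⟩, l, r⟩ h ⟨⟨i', j'⟩, l', r'⟩ h' e
    simp only [mem_sigma, HasAntidiagonal.mem_antidiagonal, mem_product, mem_ts] at h h'
    simp only [node.injEq] at e
    obtain ⟨rfl, rfl⟩ := e
    obtain ⟨_, rfl, rfl⟩ := h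
    obtain ⟨_, rfl, rfl⟩ := h'
    rfl
  · intro T hT
    rw [mem_ts] at hT
    cases T with
    | leaf => simp [V] at hT
    | node l r =>
      simp only [V] at hT
      refine ⟨⟨(l.V, r.V), l, r⟩, ?_, rfl⟩
      simp only [mem_sigma, HasAntidiagonal.mem_antidiagonal, mem_product, mem_ts, and_true]
      omega
  · intros; rfl

theorem ts_zero : ts 0 = {leaf} := by
  ext T
  rw [mem_ts]
  cases T <;> simp [V]

/-- the jump polynomial in the shifted variable -/
noncomputable def N (n : ℕ) : Polynomial ℚ := ∑ T ∈ ts n, (1 + Polynomial.X) ^ T.J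

theorem N_zero : N 0 = 1 := by simp [N, ts_zero, J]

theorem N_succ (n : ℕ) : N (n + 1) = ∑ p ∈ antidiagonal n,
    ((if p.1 = 0 then 1 else (1 + Polynomial.X)) * N p.1) * N p.2 := by
  rw [N, sum_ts_succ]
  refine Finset.sum_congr rfl fun p _ => ?_
  rw [N, N, mul_assoc, Finset.sum_mul_sum, Finset.mul_sum]
  refine Finset.sum_congr rfl fun l hl => ?_
  rw [Finset.mul_sum]
  refine Finset.sum_congr rfl fun r _ => ?_
  rw [mem_ts] at hl
  cases l with
  | leaf =>
    simp only [V] at hl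
    simp [J, ← hl]
  | node a b =>
    simp only [V] at hl
    rw [if_neg (by omega)]
    simp only [J]
    ring

open PowerSeries in
/-- generating function -/
noncomputable def G : PowerSeries (Polynomial ℚ) := PowerSeries.mk N

/-- the shifted variable t = 1 + u -/
noncomputable def t : Polynomial ℚ := 1 + Polynomial.X

open PowerSeries in
theorem G_eq : G = 1 + X * ((C t * G + C (1 - t)) * G) := by
  ext1 n
  cases n with
  | zero => simp [G, N_zero]
  | succ n =>
    rw [map_add, coeff_succ_X_mul, coeff_mul, G, coeff_mk, N_succ]
    simp only [coeff_one, Nat.succ_ne_zero, if_false, zero_add, coeff_mk, map_add, coeff_C_mul,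
      coeff_C]
    refine Finset.sum_congr rfl fun p _ => ?_
    congr 1
    split_ifs with h
    · rw [h, N_zero]; ring
    · simp [t]

open PowerSeries in
/-- square root of the discriminant -/
noncomputable def W : PowerSeries (Polynomial ℚ) := 2 * X * C t * G - (1 - X + X * C t)

open PowerSeries in
theorem W_sq : W ^ 2 = 1 - C (2 * (1 + t)) * X + C ((1 - t) ^ 2) * X ^ 2 := by
  have h := G_eq
  simp only [W, map_sub, map_mul, map_add, map_pow, map_one, map_ofNat] at *
  linear_combination (-4 * X * C t) * h

open PowerSeries in
theorem W_ode : (1 - C (2 * (1 + t)) * X + C ((1 - t) ^ 2) * X ^ 2) * derivative _ W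
    = (C ((1 - t) ^ 2) * X - C (1 + t)) * W := by
  have h := congrArg (derivative (Polynomial ℚ)) W_sq
  have h2 : (2 : PowerSeries (Polynomial ℚ)) ≠ 0 := by
    intro h0
    rw [← map_ofNat C, map_eq_zero_iff _ C_injective] at h0
    exact two_ne_zero h0
  apply mul_left_cancel₀ h2
  rw [← W_sq]
  simp only [map_add, map_sub, Derivation.leibniz, Derivation.leibniz_pow, derivative_C,
    derivative_X, derivative_one] at h
  simp only [smul_eq_mul, nsmul_eq_mul, map_mul, map_ofNat, map_add, map_one, map_pow, map_sub] at *
  push_cast at h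
  simp only [pow_one, Nat.reduceSub, mul_one, mul_zero, add_zero, zero_sub] at h
  linear_combination W * h

open PowerSeries in
theorem coeff_W (n : ℕ) : coeff (n + 2) W = 2 * t * N (n + 1) := by
  have : W = C (2 * t) * (X * G) - (1 - X + X * C t) := by
    simp only [W, map_mul, map_ofNat]; ring
  rw [this]
  rw [map_sub, coeff_C_mul, coeff_succ_X_mul]
  simp [coeff_one, coeff_X, G]

open PowerSeries in
theorem W_rec (m : ℕ) : ((m : Polynomial ℚ) + 3) * coeff (m + 3) W =
    (2 * m + 3) * (1 + t) * coeff (m + 2) W - m * (1 - t) ^ 2 * coeff (m + 1) W := by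
  have h := congrArg (coeff (m + 2)) W_ode
  have e1 : (1 - C (2 * (1 + t)) * X + C ((1 - t) ^ 2) * X ^ 2) * derivative _ W
    = derivative _ W - C (2 * (1 + t)) * (X * derivative _ W)
      + C ((1 - t) ^ 2) * (X * (X * derivative _ W)) := by ring
  have e2 : (C ((1 - t) ^ 2) * X - C (1 + t)) * W
    = C ((1 - t) ^ 2) * (X * W) - C (1 + t) * W := by ring
  rw [e1, e2] at h
  simp only [map_add (coeff _), map_sub (coeff _), coeff_C_mul, coeff_succ_X_mul, coeff_derivative] at h
  push_cast at h
  linear_combination h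

theorem t_ne : t ≠ 0 := by
  intro h
  have := congrArg (Polynomial.eval 0) h
  simp [t] at this

theorem N_one : N 1 = 1 := by
  rw [N_succ]; simp [N_zero]

theorem N_two : N 2 = 2 + Polynomial.X := by
  rw [N_succ]
  simp [Finset.antidiagonal, Finset.Nat.antidiagonal_succ, N_zero, N_one]
  ring

theorem N_rec (m : ℕ) : ((m : Polynomial ℚ) + 4) * N (m + 3) =
    (2 * (m : Polynomial ℚ) + 5) * (2 + Polynomial.X) * N (m + 2)
      - ((m : Polynomial ℚ) + 1) * Polynomial.X ^ 2 * N (m + 1) := by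
  have h := W_rec (m + 1)
  rw [show m + 1 + 3 = (m + 2) + 2 by ring, show m + 1 + 2 = (m + 1) + 2 by ring,
    show m + 1 + 1 = m + 2 by ring, coeff_W, coeff_W, coeff_W] at h
  have h2 : 2 * t ≠ 0 := mul_ne_zero two_ne_zero t_ne
  apply mul_left_cancel₀ h2
  have ht : (Polynomial.X : Polynomial ℚ) = t - 1 := by simp [t]
  rw [ht]
  push_cast at h
  linear_combination h

/-- binomial moments -/
noncomputable def a (k n : ℕ) : ℚ := (N n).coeff k

theorem a_eq (k n : ℕ) : a k n = ∑ T ∈ ts n, (T.J.choose k : ℚ) := by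
  simp [a, N, Polynomial.finsetSum_coeff, Polynomial.coeff_one_add_X_pow]

theorem a_rec' (m : ℕ) (k : ℕ) : ((m : ℚ) + 4) * a k (m + 3) =
    (2 * m + 5) * (2 * a k (m + 2) + (Polynomial.X * N (m + 2)).coeff k)
      - (m + 1) * (Polynomial.X * (Polynomial.X * N (m + 1))).coeff k := by
  have h := congrArg (fun p => Polynomial.coeff p k) (N_rec m)
  have e1 : ((m : Polynomial ℚ) + 4) * N (m + 3) = Polynomial.C ((m : ℚ) + 4) * N (m + 3) := by
    simp only [map_add, map_natCast, map_ofNat]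
  have e2 : (2 * (m : Polynomial ℚ) + 5) * (2 + Polynomial.X) * N (m + 2)
      - ((m : Polynomial ℚ) + 1) * Polynomial.X ^ 2 * N (m + 1) =
      Polynomial.C (2 * (m : ℚ) + 5) * (Polynomial.C 2 * N (m + 2) + Polynomial.X * N (m + 2))
      - Polynomial.C ((m : ℚ) + 1) * (Polynomial.X * (Polynomial.X * N (m + 1))) := by
    simp only [map_add, map_mul, map_natCast, map_ofNat, map_one]
    ring
  rw [e1, e2] at h
  simpa only [a, Polynomial.coeff_sub, Polynomial.coeff_add, Polynomial.coeff_C_mul] using h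

theorem a_rec0 (m : ℕ) : ((m : ℚ) + 4) * a 0 (m + 3) = (2 * m + 5) * (2 * a 0 (m + 2)) := by
  rw [a_rec']; simp

theorem a_rec1 (m : ℕ) : ((m : ℚ) + 4) * a 1 (m + 3) =
    (2 * m + 5) * (2 * a 1 (m + 2) + a 0 (m + 2)) := by
  rw [a_rec', Polynomial.coeff_X_mul, Polynomial.coeff_X_mul]; simp [a]

theorem a_rec2 (k m : ℕ) : ((m : ℚ) + 4) * a (k + 2) (m + 3) =
    (2 * m + 5) * (2 * a (k + 2) (m + 2) + a (k + 1) (m + 2)) - (m + 1) * a k (m + 1) := by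
  rw [a_rec', Polynomial.coeff_X_mul, Polynomial.coeff_X_mul, Polynomial.coeff_X_mul]; simp [a]

theorem two_step (P : ℕ → Prop) (h1 : P 0) (h2 : P 1)
    (h : ∀ m, P m → P (m + 1) → P (m + 2)) (n : ℕ) : P n := by
  have : P n ∧ P (n + 1) := by
    induction n with
    | zero => exact ⟨h1, h2⟩
    | succ n ih => exact ⟨ih.2, h n ih.1 ih.2⟩
  exact this.1

theorem odd_ne (m j : ℕ) : (2 * (m : ℚ) + 1 - 2 * j) ≠ 0 := by
  intro h
  have h2 : (2 * (m : ℤ) + 1 - 2 * j) = 0 := by exact_mod_cast h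
  omega

theorem odd_p5 (m : ℕ) : 2 * (m : ℚ) + 5 ≠ 0 := by
  have := odd_ne (m + 2) 0
  push_cast at this
  convert this using 1
  ring

theorem odd_p3 (m : ℕ) : 2 * (m : ℚ) + 3 ≠ 0 := by
  have := odd_ne (m + 1) 0
  push_cast at this
  convert this using 1
  ring

theorem odd_p1 (m : ℕ) : 2 * (m : ℚ) + 1 ≠ 0 := by
  have := odd_ne (m + 0) 0
  push_cast at this
  convert this using 1
  ring

theorem odd_q1 (m : ℕ) : 2 * (m : ℚ) - 1 ≠ 0 := by
  have := odd_ne (m + 0) 1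
  push_cast at this
  convert this using 1
  ring

theorem odd_q3 (m : ℕ) : 2 * (m : ℚ) - 3 ≠ 0 := by
  have := odd_ne (m + 0) 2
  push_cast at this
  convert this using 1
  ring

theorem odd_q5 (m : ℕ) : 2 * (m : ℚ) - 5 ≠ 0 := by
  have := odd_ne (m + 0) 3
  push_cast at this
  convert this using 1
  ring

/-- normalised binomial moment 0, at n = m + 1 -/
def r0 (m : ℚ) : ℚ := 1 / (1)

/-- normalised binomial moment 1, at n = m + 1 -/
def r1 (m : ℚ) : ℚ := m / (2)

/-- normalised binomial moment 2, at n = m + 1 -/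
def r2 (m : ℚ) : ℚ := m * (m - 1) * m / (4 * (2 * m + 1))

/-- normalised binomial moment 3, at n = m + 1 -/
def r3 (m : ℚ) : ℚ := m * (m - 1) * (m - 2) * (m - 1) / (24 * (2 * m + 1))

/-- normalised binomial moment 4, at n = m + 1 -/
def r4 (m : ℚ) : ℚ := m * (m - 1) * (m - 2) * (m - 3) * (m - 1) * (m - 2) / (96 * (2 * m + 1) * (2 * m - 1))

/-- normalised binomial moment 5, at n = m + 1 -/
def r5 (m : ℚ) : ℚ := m * (m - 1) * (m - 2) * (m - 3) * (m - 4) * (m - 2) * (m - 3) / (960 * (2 * m + 1) * (2 * m - 1))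

/-- normalised binomial moment 6, at n = m + 1 -/
def r6 (m : ℚ) : ℚ := m * (m - 1) * (m - 2) * (m - 3) * (m - 4) * (m - 5) * (m - 2) * (m - 3) * (m - 4) / (5760 * (2 * m + 1) * (2 * m - 1) * (2 * m - 3))

/-- normalised binomial moment 7, at n = m + 1 -/
def r7 (m : ℚ) : ℚ := m * (m - 1) * (m - 2) * (m - 3) * (m - 4) * (m - 5) * (m - 6) * (m - 3) * (m - 4) * (m - 5) / (80640 * (2 * m + 1) * (2 * m - 1) * (2 * m - 3))

/-- normalised binomial moment 8, at n = m + 1 -/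
def r8 (m : ℚ) : ℚ := m * (m - 1) * (m - 2) * (m - 3) * (m - 4) * (m - 5) * (m - 6) * (m - 7) * (m - 3) * (m - 4) * (m - 5) * (m - 6) / (645120 * (2 * m + 1) * (2 * m - 1) * (2 * m - 3) * (2 * m - 5))

theorem a0_zero : a 0 1 = 1 := by simp [a, N_one]

theorem a0_one : a 0 2 = 2 := by simp [a, N_two]

theorem ak_zero (k : ℕ) : a (k + 1) 1 = 0 := by
  simp [a, N_one, Polynomial.coeff_one]

theorem a1_one : a 1 2 = 1 := by
  simp [a, N_two, Polynomial.coeff_X]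

theorem ak_one (k : ℕ) : a (k + 2) 2 = 0 := by
  simp [a, N_two, Polynomial.coeff_X]

theorem a0_ratio (m : ℕ) : ((m : ℚ) + 3) * a 0 (m + 2) = (2 * m + 3) * (2 * a 0 (m + 1)) := by
  cases m with
  | zero => rw [a0_zero, a0_one]; norm_num
  | succ m => have := a_rec0 m; push_cast; linear_combination this

theorem a0_step (m : ℕ) : a 0 (m + 2) = a 0 (m + 1) * (2 * (2 * m + 3) / (m + 3)) := by
  have := a0_ratio m
  have h : (m : ℚ) + 3 ≠ 0 := by positivity
  field_simp
  linear_combination this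

theorem a1_closed (n : ℕ) : a 1 (n + 1) = a 0 (n + 1) * r1 n := by
  induction n using two_step with
  | h1 => rw [ak_zero 0]; norm_num [r1]
  | h2 => rw [a1_one, a0_one]; norm_num [r1]
  | h m ih1 ih2 =>
    have h := a_rec1 m
    have s1 := a0_step m
    have s2 := a0_step (m + 1)
    have h4 : (m : ℚ) + 4 ≠ 0 := by positivity
    have h3 : (m : ℚ) + 3 ≠ 0 := by positivity
    have p5 := odd_p5 m
    have p3 := odd_p3 m
    have p1 := odd_p1 m
    have q1 := odd_q1 m
    have q3 := odd_q3 m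
    have q5 := odd_q5 m
    apply mul_left_cancel₀ h4
    rw [show m + 2 + 1 = m + 3 by ring, h]
    try simp only [Nat.reduceAdd, Nat.reduceSub, zero_add] at *
    rw [show m + 1 + 2 = m + 3 by ring, show m + 1 + 1 = m + 2 by ring] at s2
    rw [show m + 1 + 1 = m + 2 by ring] at ih2
    rw [ih2, s2, s1]
    push_cast
    have e0 : r1 ((m : ℚ) + 2) = (m + 2) / (2) := by
      simp only [r1]; try ring
    have e1 : r1 ((m : ℚ) + 1) = (m + 1) / (2) := by
      simp only [r1]; try ring
    rw [e0, e1, show (m : ℚ) + 1 + 3 = m + 4 by ring, show 2 * ((m : ℚ) + 1) + 3 = 2 * m + 5 by ring]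
    field_simp
    ring

theorem a2_closed (n : ℕ) : a 2 (n + 1) = a 0 (n + 1) * r2 n := by
  induction n using two_step with
  | h1 => rw [ak_zero 1]; norm_num [r2]
  | h2 => rw [ak_one 0, a0_one]; norm_num [r2]
  | h m ih1 ih2 =>
    have h := a_rec2 0 m
    have s1 := a0_step m
    have s2 := a0_step (m + 1)
    have h4 : (m : ℚ) + 4 ≠ 0 := by positivity
    have h3 : (m : ℚ) + 3 ≠ 0 := by positivity
    have p5 := odd_p5 m
    have p3 := odd_p3 m
    have p1 := odd_p1 m
    have q1 := odd_q1 m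
    have q3 := odd_q3 m
    have q5 := odd_q5 m
    apply mul_left_cancel₀ h4
    rw [show m + 2 + 1 = m + 3 by ring, h]
    try simp only [Nat.reduceAdd, Nat.reduceSub, zero_add] at *
    have c0 := a1_closed (m + 1)
    rw [show m + 1 + 2 = m + 3 by ring, show m + 1 + 1 = m + 2 by ring] at s2
    rw [show m + 1 + 1 = m + 2 by ring] at ih2
    rw [show m + 1 + 1 = m + 2 by ring] at c0
    rw [ih2, c0, s2, s1]
    push_cast
    have e0 : r2 ((m : ℚ) + 2) = (m + 2) * (m + 1) * (m + 2) / (4 * (2 * m + 5)) := by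
      simp only [r2]; try ring
    have e1 : r2 ((m : ℚ) + 1) = (m + 1) * m * (m + 1) / (4 * (2 * m + 3)) := by
      simp only [r2]; try ring
    have e2 : r1 ((m : ℚ) + 1) = (m + 1) / (2) := by
      simp only [r1]; try ring
    rw [e0, e1, e2, show (m : ℚ) + 1 + 3 = m + 4 by ring, show 2 * ((m : ℚ) + 1) + 3 = 2 * m + 5 by ring]
    field_simp
    ring

theorem a3_closed (n : ℕ) : a 3 (n + 1) = a 0 (n + 1) * r3 n := by
  induction n using two_step with
  | h1 => rw [ak_zero 2]; norm_num [r3]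
  | h2 => rw [ak_one 1, a0_one]; norm_num [r3]
  | h m ih1 ih2 =>
    have h := a_rec2 1 m
    have s1 := a0_step m
    have s2 := a0_step (m + 1)
    have h4 : (m : ℚ) + 4 ≠ 0 := by positivity
    have h3 : (m : ℚ) + 3 ≠ 0 := by positivity
    have p5 := odd_p5 m
    have p3 := odd_p3 m
    have p1 := odd_p1 m
    have q1 := odd_q1 m
    have q3 := odd_q3 m
    have q5 := odd_q5 m
    apply mul_left_cancel₀ h4
    rw [show m + 2 + 1 = m + 3 by ring, h]
    try simp only [Nat.reduceAdd, Nat.reduceSub, zero_add] at *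
    have c0 := a2_closed (m + 1)
    have c1 := a1_closed m
    rw [show m + 1 + 2 = m + 3 by ring, show m + 1 + 1 = m + 2 by ring] at s2
    rw [show m + 1 + 1 = m + 2 by ring] at ih2
    rw [show m + 1 + 1 = m + 2 by ring] at c0
    rw [ih2, c0, c1, s2, s1]
    push_cast
    have e0 : r3 ((m : ℚ) + 2) = (m + 2) * (m + 1) * m * (m + 1) / (24 * (2 * m + 5)) := by
      simp only [r3]; try ring
    have e1 : r3 ((m : ℚ) + 1) = (m + 1) * m * (m - 1) * m / (24 * (2 * m + 3)) := by
      simp only [r3]; try ring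
    have e2 : r2 ((m : ℚ) + 1) = (m + 1) * m * (m + 1) / (4 * (2 * m + 3)) := by
      simp only [r2]; try ring
    have e3 : r1 (m : ℚ) = m / (2) := by
      simp only [r1]; try ring
    rw [e0, e1, e2, e3, show (m : ℚ) + 1 + 3 = m + 4 by ring, show 2 * ((m : ℚ) + 1) + 3 = 2 * m + 5 by ring]
    field_simp
    ring

theorem a4_closed (n : ℕ) : a 4 (n + 1) = a 0 (n + 1) * r4 n := by
  induction n using two_step with
  | h1 => rw [ak_zero 3]; norm_num [r4]
  | h2 => rw [ak_one 2, a0_one]; norm_num [r4]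
  | h m ih1 ih2 =>
    have h := a_rec2 2 m
    have s1 := a0_step m
    have s2 := a0_step (m + 1)
    have h4 : (m : ℚ) + 4 ≠ 0 := by positivity
    have h3 : (m : ℚ) + 3 ≠ 0 := by positivity
    have p5 := odd_p5 m
    have p3 := odd_p3 m
    have p1 := odd_p1 m
    have q1 := odd_q1 m
    have q3 := odd_q3 m
    have q5 := odd_q5 m
    apply mul_left_cancel₀ h4
    rw [show m + 2 + 1 = m + 3 by ring, h]
    try simp only [Nat.reduceAdd, Nat.reduceSub, zero_add] at *
    have c0 := a3_closed (m + 1)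
    have c1 := a2_closed m
    rw [show m + 1 + 2 = m + 3 by ring, show m + 1 + 1 = m + 2 by ring] at s2
    rw [show m + 1 + 1 = m + 2 by ring] at ih2
    rw [show m + 1 + 1 = m + 2 by ring] at c0
    rw [ih2, c0, c1, s2, s1]
    push_cast
    have e0 : r4 ((m : ℚ) + 2) = (m + 2) * (m + 1) * m * (m - 1) * (m + 1) * m / (96 * (2 * m + 5) * (2 * m + 3)) := by
      simp only [r4]; try ring
    have e1 : r4 ((m : ℚ) + 1) = (m + 1) * m * (m - 1) * (m - 2) * m * (m - 1) / (96 * (2 * m + 3) * (2 * m + 1)) := by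
      simp only [r4]; try ring
    have e2 : r3 ((m : ℚ) + 1) = (m + 1) * m * (m - 1) * m / (24 * (2 * m + 3)) := by
      simp only [r3]; try ring
    have e3 : r2 (m : ℚ) = m * (m - 1) * m / (4 * (2 * m + 1)) := by
      simp only [r2]; try ring
    rw [e0, e1, e2, e3, show (m : ℚ) + 1 + 3 = m + 4 by ring, show 2 * ((m : ℚ) + 1) + 3 = 2 * m + 5 by ring]
    field_simp
    ring

theorem a5_closed (n : ℕ) : a 5 (n + 1) = a 0 (n + 1) * r5 n := by
  induction n using two_step with
  | h1 => rw [ak_zero 4]; norm_num [r5]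
  | h2 => rw [ak_one 3, a0_one]; norm_num [r5]
  | h m ih1 ih2 =>
    have h := a_rec2 3 m
    have s1 := a0_step m
    have s2 := a0_step (m + 1)
    have h4 : (m : ℚ) + 4 ≠ 0 := by positivity
    have h3 : (m : ℚ) + 3 ≠ 0 := by positivity
    have p5 := odd_p5 m
    have p3 := odd_p3 m
    have p1 := odd_p1 m
    have q1 := odd_q1 m
    have q3 := odd_q3 m
    have q5 := odd_q5 m
    apply mul_left_cancel₀ h4
    rw [show m + 2 + 1 = m + 3 by ring, h]
    try simp only [Nat.reduceAdd, Nat.reduceSub, zero_add] at *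
    have c0 := a4_closed (m + 1)
    have c1 := a3_closed m
    rw [show m + 1 + 2 = m + 3 by ring, show m + 1 + 1 = m + 2 by ring] at s2
    rw [show m + 1 + 1 = m + 2 by ring] at ih2
    rw [show m + 1 + 1 = m + 2 by ring] at c0
    rw [ih2, c0, c1, s2, s1]
    push_cast
    have e0 : r5 ((m : ℚ) + 2) = (m + 2) * (m + 1) * m * (m - 1) * (m - 2) * m * (m - 1) / (960 * (2 * m + 5) * (2 * m + 3)) := by
      simp only [r5]; try ring
    have e1 : r5 ((m : ℚ) + 1) = (m + 1) * m * (m - 1) * (m - 2) * (m - 3) * (m - 1) * (m - 2) / (960 * (2 * m + 3) * (2 * m + 1)) := by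
      simp only [r5]; try ring
    have e2 : r4 ((m : ℚ) + 1) = (m + 1) * m * (m - 1) * (m - 2) * m * (m - 1) / (96 * (2 * m + 3) * (2 * m + 1)) := by
      simp only [r4]; try ring
    have e3 : r3 (m : ℚ) = m * (m - 1) * (m - 2) * (m - 1) / (24 * (2 * m + 1)) := by
      simp only [r3]; try ring
    rw [e0, e1, e2, e3, show (m : ℚ) + 1 + 3 = m + 4 by ring, show 2 * ((m : ℚ) + 1) + 3 = 2 * m + 5 by ring]
    field_simp
    ring

theorem a6_closed (n : ℕ) : a 6 (n + 1) = a 0 (n + 1) * r6 n := by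
  induction n using two_step with
  | h1 => rw [ak_zero 5]; norm_num [r6]
  | h2 => rw [ak_one 4, a0_one]; norm_num [r6]
  | h m ih1 ih2 =>
    have h := a_rec2 4 m
    have s1 := a0_step m
    have s2 := a0_step (m + 1)
    have h4 : (m : ℚ) + 4 ≠ 0 := by positivity
    have h3 : (m : ℚ) + 3 ≠ 0 := by positivity
    have p5 := odd_p5 m
    have p3 := odd_p3 m
    have p1 := odd_p1 m
    have q1 := odd_q1 m
    have q3 := odd_q3 m
    have q5 := odd_q5 m
    apply mul_left_cancel₀ h4
    rw [show m + 2 + 1 = m + 3 by ring, h]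
    try simp only [Nat.reduceAdd, Nat.reduceSub, zero_add] at *
    have c0 := a5_closed (m + 1)
    have c1 := a4_closed m
    rw [show m + 1 + 2 = m + 3 by ring, show m + 1 + 1 = m + 2 by ring] at s2
    rw [show m + 1 + 1 = m + 2 by ring] at ih2
    rw [show m + 1 + 1 = m + 2 by ring] at c0
    rw [ih2, c0, c1, s2, s1]
    push_cast
    have e0 : r6 ((m : ℚ) + 2) = (m + 2) * (m + 1) * m * (m - 1) * (m - 2) * (m - 3) * m * (m - 1) * (m - 2) / (5760 * (2 * m + 5) * (2 * m + 3) * (2 * m + 1)) := by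
      simp only [r6]; try ring
    have e1 : r6 ((m : ℚ) + 1) = (m + 1) * m * (m - 1) * (m - 2) * (m - 3) * (m - 4) * (m - 1) * (m - 2) * (m - 3) / (5760 * (2 * m + 3) * (2 * m + 1) * (2 * m - 1)) := by
      simp only [r6]; try ring
    have e2 : r5 ((m : ℚ) + 1) = (m + 1) * m * (m - 1) * (m - 2) * (m - 3) * (m - 1) * (m - 2) / (960 * (2 * m + 3) * (2 * m + 1)) := by
      simp only [r5]; try ring
    have e3 : r4 (m : ℚ) = m * (m - 1) * (m - 2) * (m - 3) * (m - 1) * (m - 2) / (96 * (2 * m + 1) * (2 * m - 1)) := by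
      simp only [r4]; try ring
    rw [e0, e1, e2, e3, show (m : ℚ) + 1 + 3 = m + 4 by ring, show 2 * ((m : ℚ) + 1) + 3 = 2 * m + 5 by ring]
    field_simp
    ring

theorem a7_closed (n : ℕ) : a 7 (n + 1) = a 0 (n + 1) * r7 n := by
  induction n using two_step with
  | h1 => rw [ak_zero 6]; norm_num [r7]
  | h2 => rw [ak_one 5, a0_one]; norm_num [r7]
  | h m ih1 ih2 =>
    have h := a_rec2 5 m
    have s1 := a0_step m
    have s2 := a0_step (m + 1)
    have h4 : (m : ℚ) + 4 ≠ 0 := by positivity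
    have h3 : (m : ℚ) + 3 ≠ 0 := by positivity
    have p5 := odd_p5 m
    have p3 := odd_p3 m
    have p1 := odd_p1 m
    have q1 := odd_q1 m
    have q3 := odd_q3 m
    have q5 := odd_q5 m
    apply mul_left_cancel₀ h4
    rw [show m + 2 + 1 = m + 3 by ring, h]
    try simp only [Nat.reduceAdd, Nat.reduceSub, zero_add] at *
    have c0 := a6_closed (m + 1)
    have c1 := a5_closed m
    rw [show m + 1 + 2 = m + 3 by ring, show m + 1 + 1 = m + 2 by ring] at s2
    rw [show m + 1 + 1 = m + 2 by ring] at ih2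
    rw [show m + 1 + 1 = m + 2 by ring] at c0
    rw [ih2, c0, c1, s2, s1]
    push_cast
    have e0 : r7 ((m : ℚ) + 2) = (m + 2) * (m + 1) * m * (m - 1) * (m - 2) * (m - 3) * (m - 4) * (m - 1) * (m - 2) * (m - 3) / (80640 * (2 * m + 5) * (2 * m + 3) * (2 * m + 1)) := by
      simp only [r7]; try ring
    have e1 : r7 ((m : ℚ) + 1) = (m + 1) * m * (m - 1) * (m - 2) * (m - 3) * (m - 4) * (m - 5) * (m - 2) * (m - 3) * (m - 4) / (80640 * (2 * m + 3) * (2 * m + 1) * (2 * m - 1)) := by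
      simp only [r7]; try ring
    have e2 : r6 ((m : ℚ) + 1) = (m + 1) * m * (m - 1) * (m - 2) * (m - 3) * (m - 4) * (m - 1) * (m - 2) * (m - 3) / (5760 * (2 * m + 3) * (2 * m + 1) * (2 * m - 1)) := by
      simp only [r6]; try ring
    have e3 : r5 (m : ℚ) = m * (m - 1) * (m - 2) * (m - 3) * (m - 4) * (m - 2) * (m - 3) / (960 * (2 * m + 1) * (2 * m - 1)) := by
      simp only [r5]; try ring
    rw [e0, e1, e2, e3, show (m : ℚ) + 1 + 3 = m + 4 by ring, show 2 * ((m : ℚ) + 1) + 3 = 2 * m + 5 by ring]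
    field_simp
    ring

theorem a8_closed (n : ℕ) : a 8 (n + 1) = a 0 (n + 1) * r8 n := by
  induction n using two_step with
  | h1 => rw [ak_zero 7]; norm_num [r8]
  | h2 => rw [ak_one 6, a0_one]; norm_num [r8]
  | h m ih1 ih2 =>
    have h := a_rec2 6 m
    have s1 := a0_step m
    have s2 := a0_step (m + 1)
    have h4 : (m : ℚ) + 4 ≠ 0 := by positivity
    have h3 : (m : ℚ) + 3 ≠ 0 := by positivity
    have p5 := odd_p5 m
    have p3 := odd_p3 m
    have p1 := odd_p1 m
    have q1 := odd_q1 m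
    have q3 := odd_q3 m
    have q5 := odd_q5 m
    apply mul_left_cancel₀ h4
    rw [show m + 2 + 1 = m + 3 by ring, h]
    try simp only [Nat.reduceAdd, Nat.reduceSub, zero_add] at *
    have c0 := a7_closed (m + 1)
    have c1 := a6_closed m
    rw [show m + 1 + 2 = m + 3 by ring, show m + 1 + 1 = m + 2 by ring] at s2
    rw [show m + 1 + 1 = m + 2 by ring] at ih2
    rw [show m + 1 + 1 = m + 2 by ring] at c0
    rw [ih2, c0, c1, s2, s1]
    push_cast
    have e0 : r8 ((m : ℚ) + 2) = (m + 2) * (m + 1) * m * (m - 1) * (m - 2) * (m - 3) * (m - 4) * (m - 5) * (m - 1) * (m - 2) * (m - 3) * (m - 4) / (645120 * (2 * m + 5) * (2 * m + 3) * (2 * m + 1) * (2 * m - 1)) := by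
      simp only [r8]; try ring
    have e1 : r8 ((m : ℚ) + 1) = (m + 1) * m * (m - 1) * (m - 2) * (m - 3) * (m - 4) * (m - 5) * (m - 6) * (m - 2) * (m - 3) * (m - 4) * (m - 5) / (645120 * (2 * m + 3) * (2 * m + 1) * (2 * m - 1) * (2 * m - 3)) := by
      simp only [r8]; try ring
    have e2 : r7 ((m : ℚ) + 1) = (m + 1) * m * (m - 1) * (m - 2) * (m - 3) * (m - 4) * (m - 5) * (m - 2) * (m - 3) * (m - 4) / (80640 * (2 * m + 3) * (2 * m + 1) * (2 * m - 1)) := by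
      simp only [r7]; try ring
    have e3 : r6 (m : ℚ) = m * (m - 1) * (m - 2) * (m - 3) * (m - 4) * (m - 5) * (m - 2) * (m - 3) * (m - 4) / (5760 * (2 * m + 1) * (2 * m - 1) * (2 * m - 3)) := by
      simp only [r6]; try ring
    rw [e0, e1, e2, e3, show (m : ℚ) + 1 + 3 = m + 4 by ring, show 2 * ((m : ℚ) + 1) + 3 = 2 * m + 5 by ring]
    field_simp
    ring

theorem choose_rec (j k : ℕ) : (j.choose (k + 1) : ℚ) = (j.choose k : ℚ) * (j - k) / (k + 1) := by
  have h := Nat.choose_succ_right_eq j k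
  have h2 : ((k : ℚ) + 1) ≠ 0 := by positivity
  rw [eq_div_iff h2]
  rcases le_or_gt k j with hk | hk
  · rw [← Nat.cast_sub hk]; exact_mod_cast h
  · rw [Nat.choose_eq_zero_of_lt hk, Nat.choose_eq_zero_of_lt (by omega)]; simp

theorem pow2_expand (j : ℕ) (x : ℚ) : ((j : ℚ) - x) ^ 2 =
    ((1) * x ^ 2) * (j.choose 0 : ℚ) +
    ((1) * x ^ 0 + (-2) * x ^ 1) * (j.choose 1 : ℚ) +
    ((2) * x ^ 0) * (j.choose 2 : ℚ) := by
  have h1 := choose_rec j 0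
  have h2 := choose_rec j 1
  norm_num only [Nat.choose_zero_right, Nat.cast_zero, Nat.cast_one, Nat.cast_ofNat, zero_add, Nat.reduceAdd] at h1 h2 ⊢
  rw [h2, h1]
  ring

theorem sum2 (n : ℕ) (x : ℚ) : ∑ T ∈ ts n, ((T.J : ℚ) - x) ^ 2 =
    ((1) * x ^ 2) * a 0 n +
    ((1) * x ^ 0 + (-2) * x ^ 1) * a 1 n +
    ((2) * x ^ 0) * a 2 n := by
  simp only [a_eq, pow2_expand, Finset.sum_add_distrib, ← Finset.mul_sum]

theorem pow8_expand (j : ℕ) (x : ℚ) : ((j : ℚ) - x) ^ 8 =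
    ((1) * x ^ 8) * (j.choose 0 : ℚ) +
    ((1) * x ^ 0 + (-8) * x ^ 1 + (28) * x ^ 2 + (-56) * x ^ 3 + (70) * x ^ 4 + (-56) * x ^ 5 + (28) * x ^ 6 + (-8) * x ^ 7) * (j.choose 1 : ℚ) +
    ((254) * x ^ 0 + (-1008) * x ^ 1 + (1736) * x ^ 2 + (-1680) * x ^ 3 + (980) * x ^ 4 + (-336) * x ^ 5 + (56) * x ^ 6) * (j.choose 2 : ℚ) +
    ((5796) * x ^ 0 + (-14448) * x ^ 1 + (15120) * x ^ 2 + (-8400) * x ^ 3 + (2520) * x ^ 4 + (-336) * x ^ 5) * (j.choose 3 : ℚ) +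
    ((40824) * x ^ 0 + (-67200) * x ^ 1 + (43680) * x ^ 2 + (-13440) * x ^ 3 + (1680) * x ^ 4) * (j.choose 4 : ℚ) +
    ((126000) * x ^ 0 + (-134400) * x ^ 1 + (50400) * x ^ 2 + (-6720) * x ^ 3) * (j.choose 5 : ℚ) +
    ((191520) * x ^ 0 + (-120960) * x ^ 1 + (20160) * x ^ 2) * (j.choose 6 : ℚ) +
    ((141120) * x ^ 0 + (-40320) * x ^ 1) * (j.choose 7 : ℚ) +
    ((40320) * x ^ 0) * (j.choose 8 : ℚ) := by
  have h1 := choose_rec j 0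
  have h2 := choose_rec j 1
  have h3 := choose_rec j 2
  have h4 := choose_rec j 3
  have h5 := choose_rec j 4
  have h6 := choose_rec j 5
  have h7 := choose_rec j 6
  have h8 := choose_rec j 7
  norm_num only [Nat.choose_zero_right, Nat.cast_zero, Nat.cast_one, Nat.cast_ofNat, zero_add, Nat.reduceAdd] at h1 h2 h3 h4 h5 h6 h7 h8 ⊢
  rw [h8, h7, h6, h5, h4, h3, h2, h1]
  ring

theorem sum8 (n : ℕ) (x : ℚ) : ∑ T ∈ ts n, ((T.J : ℚ) - x) ^ 8 =
    ((1) * x ^ 8) * a 0 n +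
    ((1) * x ^ 0 + (-8) * x ^ 1 + (28) * x ^ 2 + (-56) * x ^ 3 + (70) * x ^ 4 + (-56) * x ^ 5 + (28) * x ^ 6 + (-8) * x ^ 7) * a 1 n +
    ((254) * x ^ 0 + (-1008) * x ^ 1 + (1736) * x ^ 2 + (-1680) * x ^ 3 + (980) * x ^ 4 + (-336) * x ^ 5 + (56) * x ^ 6) * a 2 n +
    ((5796) * x ^ 0 + (-14448) * x ^ 1 + (15120) * x ^ 2 + (-8400) * x ^ 3 + (2520) * x ^ 4 + (-336) * x ^ 5) * a 3 n +
    ((40824) * x ^ 0 + (-67200) * x ^ 1 + (43680) * x ^ 2 + (-13440) * x ^ 3 + (1680) * x ^ 4) * a 4 n +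
    ((126000) * x ^ 0 + (-134400) * x ^ 1 + (50400) * x ^ 2 + (-6720) * x ^ 3) * a 5 n +
    ((191520) * x ^ 0 + (-120960) * x ^ 1 + (20160) * x ^ 2) * a 6 n +
    ((141120) * x ^ 0 + (-40320) * x ^ 1) * a 7 n +
    ((40320) * x ^ 0) * a 8 n := by
  simp only [a_eq, pow8_expand, Finset.sum_add_distrib, ← Finset.mul_sum]

theorem card_eq (n : ℕ) : (Nat.card {T : BTree // T.V = n} : ℚ) = a 0 n := by
  rw [a_eq]
  simp only [Nat.choose_zero_right, Nat.cast_one, Finset.sum_const, nsmul_eq_mul, mul_one]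
  congr 1
  rw [ts, ← Set.ncard_eq_toFinset_card _ (finite_V n)]
  rfl

theorem a0_ne (n : ℕ) : a 0 (n + 1) ≠ 0 := by
  induction n with
  | zero => rw [a0_zero]; norm_num
  | succ n ih =>
    rw [a0_step]
    have : 2 * (2 * (n : ℚ) + 3) / (n + 3) ≠ 0 := by positivity
    exact mul_ne_zero ih this

theorem finsum_eq (n : ℕ) (f : BTree → ℚ) :
    (∑ᶠ T ∈ {T : BTree | T.V = n}, f T) = ∑ T ∈ ts n, f T :=
  finsum_mem_eq_finite_toFinset_sum f (finite_V n)

end BTree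

/-- The scaled eighth central moment of the number-of-jumps statistic over
full binary trees with n ≥ 1 internal vertices:
μ₈·(8n⁹ − 60n⁸ + 118n⁷ + 75n⁶ − 402n⁵ + 135n⁴ + 418n³ − 255n² − 142n + 105)
  = μ₂⁴·(840n⁹ − 7980n⁸ + 27006n⁷ − 38933n⁶ + 23070n⁵ − 6937n⁴ + 3178n³ − 1167n² − 142n + 105). -/
theorem stmt_13 (n : ℕ) (hn : 1 ≤ n)
    (μ : ℕ → ℚ)
    (hμ : ∀ k, μ k =
      (∑ᶠ T ∈ {T : BTree | T.V = n}, ((T.J : ℚ) - ((n : ℚ) - 1) / 2) ^ k) /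
        (Nat.card {T : BTree // T.V = n} : ℚ)) :
    μ 8 * (8 * (n : ℚ) ^ 9 - 60 * n ^ 8 + 118 * n ^ 7 + 75 * n ^ 6 - 402 * n ^ 5 + 135 * n ^ 4
        + 418 * n ^ 3 - 255 * n ^ 2 - 142 * n + 105) =
      (μ 2) ^ 4 *
        (840 * (n : ℚ) ^ 9 - 7980 * n ^ 8 + 27006 * n ^ 7 - 38933 * n ^ 6 + 23070 * n ^ 5
          - 6937 * n ^ 4 + 3178 * n ^ 3 - 1167 * n ^ 2 - 142 * n + 105) := by
  obtain ⟨m, rfl⟩ : ∃ m, n = m + 1 := ⟨n - 1, by omega⟩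
  have h0 := BTree.a0_ne m
  have h2 : μ 2 = _ := hμ 2
  have h8 : μ 8 = _ := hμ 8
  rw [BTree.finsum_eq, BTree.sum2, BTree.card_eq, BTree.a2_closed, BTree.a1_closed] at h2
  rw [BTree.finsum_eq, BTree.sum8, BTree.card_eq, BTree.a8_closed, BTree.a7_closed,
    BTree.a6_closed, BTree.a5_closed, BTree.a4_closed, BTree.a3_closed, BTree.a2_closed,
    BTree.a1_closed] at h8
  generalize BTree.a 0 (m + 1) = c at h0 h2 h8
  have p1 : 2 * (m : ℚ) + 1 ≠ 0 := by positivity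
  have q1 : 2 * (m : ℚ) - 1 ≠ 0 := by
    have := BTree.odd_ne m 1
    push_cast at this
    convert this using 1
    ring
  have q3 : 2 * (m : ℚ) - 3 ≠ 0 := by
    have := BTree.odd_ne m 2
    push_cast at this
    convert this using 1
    ring
  have q5 : 2 * (m : ℚ) - 5 ≠ 0 := by
    have := BTree.odd_ne m 3
    push_cast at this
    convert this using 1
    ring
  push_cast at *
  rw [show (m : ℚ) + 1 - 1 = m by ring] at *
  simp only [BTree.r1, BTree.r2, BTree.r3, BTree.r4, BTree.r5, BTree.r6, BTree.r7, BTree.r8,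
    pow_zero, pow_one, one_mul, mul_one]
    at h2 h8
  generalize (m : ℚ) = x at *
  clear hμ
  generalize hA : 2 * x + 1 = A at *
  generalize hB : 2 * x - 1 = B at *
  generalize hC : 2 * x - 3 = C at *
  generalize hD : 2 * x - 5 = D at *
  have e2 : μ 2 = x * (x + 2) / (4 * A) := by
    rw [h2]; field_simp; rw [← hA]; ring
  rw [e2, h8]
  field_simp
  rw [← hA, ← hB, ← hC, ← hD]
  ring
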